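/- arXiv:1806.03201 — 6 statements merged into one kernel-verified Lean document; each statement's English description precedes it below -/
import Mathlib

section
/- There exists a Borel measurable, locally bounded function F : ℝ × ℝ → ℝ satisfying F(x,y) = W(x−y) + ∫_y^x W(x−z) ω(z) F(z,y) dz for all x, y ∈ ℝ (equation (A)), where for x < y the integral ∫_y^x is interpreted as −∫_x^y. (Moreover F(x,y) = W(x−y) = 0 whenever x < y.) -/
open MeasureTheory Set

noncomputable section

/-- A real-valued function is locally bounded if it is bounded on every compact set. -/
def LocBdd {α : Type*} [TopologicalSpace α] (f : α → ℝ) : Prop :=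
  ∀ K : Set α, IsCompact K → ∃ C : ℝ, ∀ x ∈ K, |f x| ≤ C

/-- The iterates of the Volterra operator with kernel `W (x - z) * ω z`, started at `W (x - y)`. -/
def volterraIterate (W ω : ℝ → ℝ) : ℕ → ℝ → ℝ → ℝ
  | 0, x, y => W (x - y)
  | n + 1, x, y => ∫ z in y..x, W (x - z) * ω z * volterraIterate W ω n z y

lemma intervalIntegral_volterra_eq_zero {W : ℝ → ℝ} (hWneg : ∀ x : ℝ, x < 0 → W x = 0)
    (ω f : ℝ → ℝ) {x y : ℝ} (h : x < y) : ∫ z in y..x, W (x - z) * ω z * f z = 0 := by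
  rw [intervalIntegral.integral_symm, intervalIntegral.integral_of_le h.le,
    setIntegral_eq_zero_of_forall_eq_zero, neg_zero]
  intro z hz
  rw [hWneg (x - z) (by linarith [hz.1])]
  simp

lemma volterraIterate_eq_zero {W : ℝ → ℝ} (ω : ℝ → ℝ) (hWneg : ∀ x : ℝ, x < 0 → W x = 0)
    (n : ℕ) {x y : ℝ} (h : x < y) : volterraIterate W ω n x y = 0 := by
  cases n with
  | zero => exact hWneg _ (by linarith)
  | succ n =>
    rw [volterraIterate, intervalIntegral_volterra_eq_zero hWneg ω _ h]

lemma volterraIterate_succ_eq_integral {W : ℝ → ℝ} (ω : ℝ → ℝ)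
    (hWneg : ∀ x : ℝ, x < 0 → W x = 0) (n : ℕ) (x y : ℝ) :
    volterraIterate W ω (n + 1) x y = ∫ z, W (x - z) * ω z * volterraIterate W ω n z y := by
  have hzero : ∀ z, z ∉ Icc y x → W (x - z) * ω z * volterraIterate W ω n z y = 0 := by
    intro z hz
    rcases lt_or_ge z y with h | h
    · rw [volterraIterate_eq_zero ω hWneg n h, mul_zero]
    · rw [hWneg (x - z) (by by_contra! h'; exact hz ⟨h, by linarith⟩)]
      simp
  rcases lt_or_ge x y with h | h
  · rw [volterraIterate_eq_zero ω hWneg _ h]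
    symm
    apply integral_eq_zero_of_ae
    exact Filter.Eventually.of_forall fun z => hzero z fun hz => by linarith [hz.1, hz.2]
  · rw [volterraIterate, intervalIntegral.integral_of_le h, ← integral_Icc_eq_integral_Ioc,
      setIntegral_eq_integral_of_forall_compl_eq_zero hzero]

lemma measurable_volterraIterate {W ω : ℝ → ℝ} (hWmeas : Measurable W) (hωmeas : Measurable ω)
    (hWneg : ∀ x : ℝ, x < 0 → W x = 0) (n : ℕ) :
    Measurable fun p : ℝ × ℝ => volterraIterate W ω n p.1 p.2 := by
  induction n with
  | zero => exact hWmeas.comp (measurable_fst.sub measurable_snd)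
  | succ n ih =>
    simp_rw [volterraIterate_succ_eq_integral ω hWneg]
    have hW : Measurable fun q : (ℝ × ℝ) × ℝ => W (q.1.1 - q.2) :=
      hWmeas.comp (by fun_prop)
    have hω : Measurable fun q : (ℝ × ℝ) × ℝ => ω q.2 := hωmeas.comp measurable_snd
    have hG : Measurable fun q : (ℝ × ℝ) × ℝ => volterraIterate W ω n q.2 q.1.2 :=
      ih.comp (g := fun p : ℝ × ℝ => volterraIterate W ω n p.1 p.2)
        (f := fun q : (ℝ × ℝ) × ℝ => (q.2, q.1.2)) (by fun_prop)
    exact ((hW.mul hω).mul hG).stronglyMeasurable.integral_prod_right.measurable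

lemma abs_volterraIterate_le_pow {W ω : ℝ → ℝ} {a b C D : ℝ}
    (hC : ∀ t ∈ Icc 0 (b - a), |W t| ≤ C) (hD : ∀ z ∈ Icc a b, |ω z| ≤ D)
    (n : ℕ) {x y : ℝ} (hay : a ≤ y) (hyx : y ≤ x) (hxb : x ≤ b) :
    |volterraIterate W ω n x y| ≤ C * (C * D) ^ n * ((x - y) ^ n / n.factorial) := by
  induction n generalizing x with
  | zero => simpa [volterraIterate] using hC _ ⟨by linarith, by linarith⟩
  | succ n ih =>
    have hC0 : 0 ≤ C := (abs_nonneg _).trans (hC 0 ⟨le_rfl, by linarith⟩)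
    have hbound : ∀ z ∈ Ioc y x, ‖W (x - z) * ω z * volterraIterate W ω n z y‖ ≤
        C * D * (C * (C * D) ^ n * ((z - y) ^ n / n.factorial)) := by
      intro z hz
      rw [Real.norm_eq_abs, abs_mul, abs_mul]
      have h1 := hC (x - z) ⟨by linarith [hz.2], by linarith [hz.1]⟩
      have h2 := hD z ⟨by linarith [hz.1], by linarith [hz.2]⟩
      have h3 := ih hz.1.le (hz.2.trans hxb)
      have hD0 : 0 ≤ D := (abs_nonneg _).trans h2
      gcongr
    rw [volterraIterate, ← Real.norm_eq_abs]
    refine (intervalIntegral.norm_integral_le_of_norm_le hyx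
      (Filter.Eventually.of_forall hbound)
      (Continuous.intervalIntegrable (by fun_prop) _ _)).trans_eq ?_
    have hpow : ∫ z in y..x, (z - y) ^ n = (x - y) ^ (n + 1) / (n + 1) := by
      rw [intervalIntegral.integral_comp_sub_right (fun z => z ^ n) y]
      simp
    simp only [intervalIntegral.integral_const_mul, intervalIntegral.integral_div, hpow,
      Nat.factorial_succ, Nat.cast_mul, Nat.cast_add, Nat.cast_one]
    field_simp
    ring

lemma abs_volterraIterate_le {W ω : ℝ → ℝ} {a b C D : ℝ}
    (hWneg : ∀ x : ℝ, x < 0 → W x = 0)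
    (hC : ∀ t ∈ Icc 0 (b - a), |W t| ≤ C) (hD : ∀ z ∈ Icc a b, |ω z| ≤ D)
    (n : ℕ) {x y : ℝ} (hx : x ∈ Icc a b) (hy : y ∈ Icc a b) :
    |volterraIterate W ω n x y| ≤ C * ((C * D * (b - a)) ^ n / n.factorial) := by
  have hab : 0 ≤ b - a := by linarith [hx.1, hx.2]
  have hC0 : 0 ≤ C := (abs_nonneg _).trans (hC 0 ⟨le_rfl, hab⟩)
  have hD0 : 0 ≤ D := (abs_nonneg _).trans (hD x hx)
  rcases lt_or_ge x y with h | h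
  · rw [volterraIterate_eq_zero ω hWneg n h, abs_zero]
    positivity
  · refine (abs_volterraIterate_le_pow hC hD n hy.1 h hx.2).trans ?_
    have hxy : 0 ≤ x - y := by linarith
    calc C * (C * D) ^ n * ((x - y) ^ n / n.factorial)
        ≤ C * (C * D) ^ n * ((b - a) ^ n / n.factorial) := by
          gcongr
          · exact hx.2
          · exact hy.1
      _ = C * ((C * D * (b - a)) ^ n / n.factorial) := by rw [mul_pow (C * D)]; ring

/-- Existence of a Borel measurable, locally bounded solution of equation (A). -/
theorem statement0
    (W ω : ℝ → ℝ)
    (hWmeas : Measurable W) (hWbdd : LocBdd W) (hWneg : ∀ x : ℝ, x < 0 → W x = 0)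
    (hωmeas : Measurable ω) (hωbdd : LocBdd ω) (hωpos : ∀ x : ℝ, 0 ≤ ω x) :
    ∃ F : ℝ × ℝ → ℝ, Measurable F ∧ LocBdd F ∧
      (∀ x y : ℝ, F (x, y) = W (x - y) + ∫ z in y..x, W (x - z) * ω z * F (z, y)) ∧
      (∀ x y : ℝ, x < y → F (x, y) = 0) := by
  set G := volterraIterate W ω
  have hsum_exp : ∀ C r : ℝ, Summable fun n : ℕ => C * (r ^ n / n.factorial) := fun C r =>
    (Real.summable_pow_div_factorial r).mul_left C
  have hsummable : ∀ x y, Summable fun n => G n x y := by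
    intro x y
    obtain ⟨C, hC⟩ := hWbdd (Icc 0 (max x y - min x y)) isCompact_Icc
    obtain ⟨D, hD⟩ := hωbdd (Icc (min x y) (max x y)) isCompact_Icc
    exact Summable.of_norm_bounded (hsum_exp C (C * D * (max x y - min x y))) fun n =>
      abs_volterraIterate_le hWneg hC hD n ⟨min_le_left _ _, le_max_left _ _⟩
        ⟨min_le_right _ _, le_max_right _ _⟩
  have hGmeas : ∀ n, Measurable fun p : ℝ × ℝ => G n p.1 p.2 :=
    measurable_volterraIterate hWmeas hωmeas hWneg
  have hzero : ∀ x y, x < y → ∑' n, G n x y = 0 := fun x y h => by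
    simp [G, volterraIterate_eq_zero ω hWneg _ h]
  refine ⟨fun p => ∑' n, G n p.1 p.2, ?_, ?_, ?_, hzero⟩
  · refine measurable_of_tendsto_metrizable
      (f := fun N (p : ℝ × ℝ) => ∑ n ∈ Finset.range N, G n p.1 p.2)
      (fun N => Finset.measurable_fun_sum _ fun n _ => hGmeas n) ?_
    exact tendsto_pi_nhds.2 fun p => (hsummable p.1 p.2).hasSum.tendsto_sum_nat
  · intro K hK
    obtain ⟨R, hR⟩ := hK.isBounded.exists_norm_le
    obtain ⟨C, hC⟩ := hWbdd (Icc 0 (R - -R)) isCompact_Icc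
    obtain ⟨D, hD⟩ := hωbdd (Icc (-R) R) isCompact_Icc
    refine ⟨∑' n : ℕ, C * ((C * D * (R - -R)) ^ n / n.factorial), fun p hp => ?_⟩
    have h1 : p.1 ∈ Icc (-R) R := abs_le.1 ((norm_fst_le p).trans (hR p hp))
    have h2 : p.2 ∈ Icc (-R) R := abs_le.1 ((norm_snd_le p).trans (hR p hp))
    exact tsum_of_norm_bounded (f := fun n => G n p.1 p.2) (hsum_exp _ _).hasSum fun n =>
      abs_volterraIterate_le hWneg hC hD n h1 h2
  · intro x y
    have hint : HasSum (fun n => G (n + 1) x y)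
        (∫ z in y..x, W (x - z) * ω z * ∑' n, G n z y) := by
      rcases lt_or_ge x y with h | h
      · rw [intervalIntegral_volterra_eq_zero hWneg ω _ h]
        simp [G, volterraIterate_eq_zero ω hWneg _ h]
      · obtain ⟨C, hC⟩ := hWbdd (Icc 0 (x - y)) isCompact_Icc
        obtain ⟨D, hD⟩ := hωbdd (Icc y x) isCompact_Icc
        have hC0 : 0 ≤ C := (abs_nonneg _).trans (hC 0 ⟨le_rfl, by linarith⟩)
        have hsum := (hsum_exp C (C * D * (x - y))).mul_left (C * D)
        refine intervalIntegral.hasSum_integral_of_dominated_convergence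
          (fun n _ => C * D * (C * ((C * D * (x - y)) ^ n / n.factorial)))
          (fun n => ?_) (fun n => ?_) ?_ ?_ ?_
        · have hG : Measurable fun z => G n z y := (hGmeas n).comp measurable_prodMk_right
          exact (((hWmeas.comp (measurable_const.sub measurable_id)).mul hωmeas).mul
            hG).aestronglyMeasurable
        · refine Filter.Eventually.of_forall fun z hz => ?_
          rw [uIoc_of_le h] at hz
          rw [Real.norm_eq_abs, abs_mul, abs_mul]
          have h1 := hC (x - z) ⟨by linarith [hz.2], by linarith [hz.1]⟩
          have h2 := hD z ⟨hz.1.le, hz.2⟩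
          have h3 := abs_volterraIterate_le hWneg hC hD n ⟨hz.1.le, hz.2⟩ ⟨le_rfl, h⟩
          have hD0 : 0 ≤ D := (abs_nonneg _).trans h2
          gcongr
        · exact Filter.Eventually.of_forall fun _ _ => hsum
        · exact intervalIntegrable_const
        · exact Filter.Eventually.of_forall fun z _ => (hsummable z y).hasSum.mul_left _
    change ∑' n, G n x y = _
    rw [(hsummable x y).tsum_eq_zero_add, hint.tsum_eq]
    rfl
end
end

section
/- If F and G are two Borel measurable, locally bounded functions from ℝ × ℝ to ℝ each satisfying equation (A), i.e. F(x,y) = W(x−y) + ∫_y^x W(x−z) ω(z) F(z,y) dz and G(x,y) = W(x−y) + ∫_y^x W(x−z) ω(z) G(z,y) dz for all x, y ∈ ℝ, then F = G. -/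
open MeasureTheory Set

noncomputable section

open scoped Nat

theorem LocBdd.mul {α : Type*} [TopologicalSpace α] {f g : α → ℝ} (hf : LocBdd f)
    (hg : LocBdd g) : LocBdd fun x => f x * g x := by
  intro K hK
  obtain ⟨A, hA⟩ := hf K hK
  obtain ⟨B, hB⟩ := hg K hK
  refine ⟨A * B, fun x hx => ?_⟩
  rw [abs_mul]
  exact mul_le_mul (hA x hx) (hB x hx) (abs_nonneg _) ((abs_nonneg _).trans (hA x hx))

theorem LocBdd.sub {α : Type*} [TopologicalSpace α] {f g : α → ℝ} (hf : LocBdd f)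
    (hg : LocBdd g) : LocBdd fun x => f x - g x := by
  intro K hK
  obtain ⟨A, hA⟩ := hf K hK
  obtain ⟨B, hB⟩ := hg K hK
  exact ⟨A + B, fun x hx => (abs_sub _ _).trans (add_le_add (hA x hx) (hB x hx))⟩

theorem LocBdd.comp {α β : Type*} [TopologicalSpace α] [TopologicalSpace β] {f : β → ℝ}
    {g : α → β} (hf : LocBdd f) (hg : Continuous g) : LocBdd fun x => f (g x) := by
  intro K hK
  obtain ⟨A, hA⟩ := hf (g '' K) (hK.image hg)
  exact ⟨A, fun x hx => hA _ (mem_image_of_mem g hx)⟩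

theorem LocBdd.intervalIntegrable {f : ℝ → ℝ} (hf : LocBdd f) (hm : Measurable f) (a b : ℝ) :
    IntervalIntegrable f volume a b := by
  obtain ⟨C, hC⟩ := hf (uIcc a b) isCompact_uIcc
  refine (intervalIntegrable_const (c := C)).mono_fun' hm.aestronglyMeasurable ?_
  filter_upwards [ae_restrict_mem measurableSet_uIoc] with x hx
  exact hC x (uIoc_subset_uIcc hx)

/-- Picard-type iterated bound for a homogeneous Volterra equation with bounded kernel. -/
theorem abs_le_of_volterra {a b K M : ℝ} {k : ℝ → ℝ → ℝ} {h : ℝ → ℝ}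
    (hk : ∀ x ∈ Icc a b, ∀ z ∈ Icc a x, |k x z| ≤ K) (hM : ∀ x ∈ Icc a b, |h x| ≤ M)
    (hh : ∀ x ∈ Icc a b, h x = ∫ z in a..x, k x z * h z) (n : ℕ) :
    ∀ x ∈ Icc a b, |h x| ≤ M * ((K * (x - a)) ^ n / n !) := by
  induction n with
  | zero => simpa using hM
  | succ n ih =>
    intro x hx
    have hint : ∫ z in a..x, K * (M * ((K * (z - a)) ^ n / n !)) =
        M * ((K * (x - a)) ^ (n + 1) / (n + 1)!) := by
      have hpow : ∫ z in a..x, (z - a) ^ n = (x - a) ^ (n + 1) / (n + 1) := by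
        rw [intervalIntegral.integral_comp_sub_right (fun z => z ^ n) a, integral_pow]
        simp
      have hcongr : ∀ z : ℝ, K * (M * ((K * (z - a)) ^ n / n !)) =
          K ^ (n + 1) * M / n ! * (z - a) ^ n := by
        intro z
        rw [mul_pow]
        ring
      simp_rw [hcongr]
      rw [intervalIntegral.integral_const_mul, hpow, Nat.factorial_succ]
      push_cast
      rw [mul_pow]
      field_simp
    rw [hh x hx, ← hint, ← Real.norm_eq_abs]
    refine intervalIntegral.norm_integral_le_of_norm_le hx.1 (ae_of_all _ fun z hz => ?_)
      (Continuous.intervalIntegrable (by fun_prop) _ _)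
    have hz' : z ∈ Icc a x := Ioc_subset_Icc_self hz
    rw [Real.norm_eq_abs, abs_mul]
    exact mul_le_mul (hk x hx z hz') (ih z ⟨hz'.1, hz'.2.trans hx.2⟩) (abs_nonneg _)
      ((abs_nonneg _).trans (hk x hx z hz'))

/-- A bounded solution of a homogeneous Volterra equation with bounded kernel vanishes. -/
theorem eq_zero_of_volterra {a b K M : ℝ} {k : ℝ → ℝ → ℝ} {h : ℝ → ℝ}
    (hk : ∀ x ∈ Icc a b, ∀ z ∈ Icc a x, |k x z| ≤ K) (hM : ∀ x ∈ Icc a b, |h x| ≤ M)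
    (hh : ∀ x ∈ Icc a b, h x = ∫ z in a..x, k x z * h z) {x : ℝ} (hx : x ∈ Icc a b) :
    h x = 0 := by
  have hlim := (FloorSemiring.tendsto_pow_div_factorial_atTop (K * (x - a))).const_mul M
  rw [mul_zero] at hlim
  exact abs_nonpos_iff.mp
    (ge_of_tendsto' hlim fun n => abs_le_of_volterra hk hM hh n x hx)

/-- Uniqueness of the Borel measurable, locally bounded solution of equation (A). -/
theorem statement1
    (W ω : ℝ → ℝ)
    (hWmeas : Measurable W) (hWbdd : LocBdd W) (hWneg : ∀ x : ℝ, x < 0 → W x = 0)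
    (hωmeas : Measurable ω) (hωbdd : LocBdd ω) (hωpos : ∀ x : ℝ, 0 ≤ ω x)
    (F G : ℝ × ℝ → ℝ)
    (hFmeas : Measurable F) (hFbdd : LocBdd F)
    (hGmeas : Measurable G) (hGbdd : LocBdd G)
    (hFA : ∀ x y : ℝ, F (x, y) = W (x - y) + ∫ z in y..x, W (x - z) * ω z * F (z, y))
    (hGA : ∀ x y : ℝ, G (x, y) = W (x - y) + ∫ z in y..x, W (x - z) * ω z * G (z, y)) :
    F = G := by
  ext ⟨x, y⟩
  have hkbdd (x : ℝ) : LocBdd fun z => W (x - z) * ω z :=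
    (hWbdd.comp (continuous_const.sub continuous_id)).mul hωbdd
  have hkmeas (x : ℝ) : Measurable fun z => W (x - z) * ω z :=
    (hWmeas.comp (measurable_const.sub measurable_id)).mul hωmeas
  have hint {H : ℝ × ℝ → ℝ} (hm : Measurable H) (hb : LocBdd H) (x : ℝ) :
      IntervalIntegrable (fun z => W (x - z) * ω z * H (z, y)) volume y x :=
    ((hkbdd x).mul (hb.comp (by fun_prop : Continuous fun z : ℝ => (z, y)))).intervalIntegrable
      ((hkmeas x).mul (hm.comp (by fun_prop))) _ _
  have hdiff (x : ℝ) : F (x, y) - G (x, y) =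
      ∫ z in y..x, W (x - z) * ω z * (F (z, y) - G (z, y)) := by
    simp_rw [mul_sub]
    rw [intervalIntegral.integral_sub (hint hFmeas hFbdd x) (hint hGmeas hGbdd x),
      hFA x y, hGA x y, add_sub_add_left_eq_sub]
  refine sub_eq_zero.mp ?_
  rcases lt_or_ge x y with hxy | hxy
  · rw [hdiff x, intervalIntegral.integral_symm, neg_eq_zero]
    refine intervalIntegral.integral_zero_ae (ae_of_all _ fun z hz => ?_)
    rw [uIoc_of_le hxy.le] at hz
    rw [hWneg _ (sub_neg.mpr hz.1), zero_mul, zero_mul]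
  · obtain ⟨A, hA⟩ := hWbdd (Icc 0 (x - y)) isCompact_Icc
    obtain ⟨B, hB⟩ := hωbdd (Icc y x) isCompact_Icc
    obtain ⟨M, hM⟩ := (hFbdd.sub hGbdd).comp
      (by fun_prop : Continuous fun z : ℝ => (z, y)) (Icc y x) isCompact_Icc
    refine eq_zero_of_volterra (a := y) (b := x) (K := A * B) (M := M)
      (k := fun x z => W (x - z) * ω z) (h := fun x => F (x, y) - G (x, y))
      (fun t ht z hz => ?_) hM (fun t _ => hdiff t) (right_mem_Icc.mpr hxy)
    have hW := hA (t - z) ⟨sub_nonneg.mpr hz.2, sub_le_sub ht.2 hz.1⟩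
    rw [abs_mul]
    exact mul_le_mul hW (hB z ⟨hz.1, hz.2.trans ht.2⟩) (abs_nonneg _) ((abs_nonneg _).trans hW)
end
end

section
/- If F : ℝ × ℝ → ℝ is a Borel measurable, locally bounded function satisfying equation (A), i.e. F(x,y) = W(x−y) + ∫_y^x W(x−z) ω(z) F(z,y) dz for all x, y ∈ ℝ, then F also satisfies the dual equation (B): F(x,y) = W(x−y) + ∫_y^x F(x,z) ω(z) W(z−y) dz for all x, y ∈ ℝ. -/
open MeasureTheory Set

noncomputable section

/-- A measurable function bounded on a measurable set of finite measure is integrable there. -/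
lemma integrableOn_of_measurable_of_bound {α : Type*} [MeasurableSpace α] {μ : Measure α}
    {s : Set α} (hs : MeasurableSet s) (hμ : μ s < ⊤) {f : α → ℝ} (hf : Measurable f) {C : ℝ}
    (hC : ∀ x ∈ s, |f x| ≤ C) : IntegrableOn f s μ :=
  Measure.integrableOn_of_bounded (M := C) hμ.ne hf.aestronglyMeasurable
    ((ae_restrict_iff' hs).2 (Filter.Eventually.of_forall hC))

/-- Integral form of Grönwall's lemma with zero initial datum, for bounded measurable functions. -/
lemma eq_zero_of_abs_le_mul_setIntegral {D : ℝ → ℝ} (hD : Measurable D) {a b C M : ℝ} (hM : 0 ≤ M)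
    (hC : ∀ x ∈ Icc a b, |D x| ≤ C)
    (h : ∀ x ∈ Icc a b, |D x| ≤ M * ∫ u in Ioc a x, |D u|) :
    ∀ x ∈ Icc a b, D x = 0 := by
  have key : ∀ n : ℕ, ∀ x ∈ Icc a b, |D x| ≤ C * ((M * (x - a)) ^ n / n.factorial) := by
    intro n
    induction n with
    | zero => simpa using hC
    | succ n ih =>
      intro x hx
      have hsub : ∀ u ∈ Ioc a x, u ∈ Icc a b := fun u hu => ⟨hu.1.le, hu.2.trans hx.2⟩
      have hint : IntegrableOn (fun u => |D u|) (Ioc a x) :=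
        integrableOn_of_measurable_of_bound measurableSet_Ioc measure_Ioc_lt_top hD.abs
          (C := C) (fun u hu => by simpa using hC u (hsub u hu))
      have hint' : IntegrableOn (fun u => C * ((M * (u - a)) ^ n / n.factorial)) (Ioc a x) :=
        (Continuous.integrableOn_Icc (by fun_prop)).mono_set Ioc_subset_Icc_self
      have hle := setIntegral_mono_on hint hint' measurableSet_Ioc
        (fun u hu => ih u (hsub u hu))
      have hval : ∫ u in Ioc a x, C * ((M * (u - a)) ^ n / n.factorial)
          = C * (M ^ n * ((x - a) ^ (n + 1) / (n + 1)) / n.factorial) := by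
        rw [← intervalIntegral.integral_of_le hx.1, intervalIntegral.integral_const_mul,
          intervalIntegral.integral_div]
        simp_rw [mul_pow]
        rw [intervalIntegral.integral_const_mul,
          intervalIntegral.integral_comp_sub_right (fun u => u ^ n) a, integral_pow]
        simp
      calc |D x| ≤ M * ∫ u in Ioc a x, |D u| := h x hx
        _ ≤ M * (C * (M ^ n * ((x - a) ^ (n + 1) / (n + 1)) / n.factorial)) := by
          rw [← hval]; exact mul_le_mul_of_nonneg_left hle hM
        _ = C * ((M * (x - a)) ^ (n + 1) / (n + 1).factorial) := by
          rw [Nat.factorial_succ]; push_cast; rw [mul_pow]; field_simp; ring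
  intro x hx
  have hlim := (FloorSemiring.tendsto_pow_div_factorial_atTop (M * (x - a))).const_mul C
  rw [mul_zero] at hlim
  exact abs_nonpos_iff.1 (ge_of_tendsto' hlim fun n => key n x hx)

/-- A solution of equation (A) also satisfies the dual equation (B). -/
theorem statement2
    (W ω : ℝ → ℝ)
    (hWmeas : Measurable W) (hWbdd : LocBdd W) (hWneg : ∀ x : ℝ, x < 0 → W x = 0)
    (hωmeas : Measurable ω) (hωbdd : LocBdd ω) (hωpos : ∀ x : ℝ, 0 ≤ ω x)
    (F : ℝ × ℝ → ℝ) (hFmeas : Measurable F) (hFbdd : LocBdd F)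
    (hFA : ∀ x y : ℝ, F (x, y) = W (x - y) + ∫ z in y..x, W (x - z) * ω z * F (z, y)) :
    ∀ x y : ℝ, F (x, y) = W (x - y) + ∫ z in y..x, F (x, z) * ω z * W (z - y) := by
  have hF0 : ∀ x y, x < y → F (x, y) = 0 := by
    intro x y hxy
    rw [hFA, hWneg _ (by linarith), intervalIntegral.integral_of_ge hxy.le,
      setIntegral_eq_zero_of_forall_eq_zero]
    · simp
    · intro z hz
      rw [hWneg _ (by linarith [hz.1])]; simp
  intro X y
  rcases lt_or_ge X y with hXy | hyX
  · rw [hF0 X y hXy, hWneg _ (by linarith), intervalIntegral.integral_of_ge hXy.le,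
      setIntegral_eq_zero_of_forall_eq_zero]
    · simp
    · intro z hz
      rw [hF0 X z hz.1]; simp
  obtain ⟨A, hA⟩ := hWbdd (Icc (y - X) (X - y)) isCompact_Icc
  obtain ⟨B, hB⟩ := hωbdd (Icc y X) isCompact_Icc
  obtain ⟨C, hC⟩ := hFbdd (Icc y X ×ˢ Icc y X) (isCompact_Icc.prod isCompact_Icc)
  have hyy : y ∈ Icc y X := ⟨le_rfl, hyX⟩
  have hA' : ∀ x ∈ Icc y X, ∀ u ∈ Icc y X, |W (x - u)| ≤ A := fun x hx u hu =>
    hA _ ⟨by linarith [hx.1, hu.2], by linarith [hx.2, hu.1]⟩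
  have hC' : ∀ x ∈ Icc y X, ∀ u ∈ Icc y X, |F (x, u)| ≤ C := fun x hx u hu => hC _ ⟨hx, hu⟩
  have hA0 : 0 ≤ A := (abs_nonneg _).trans (hA' y hyy y hyy)
  have hB0 : 0 ≤ B := (abs_nonneg _).trans (hB y hyy)
  have hC0 : 0 ≤ C := (abs_nonneg _).trans (hC' y hyy y hyy)
  have hWy : ∀ u ∈ Icc y X, |W (u - y)| ≤ A := fun u hu => hA' u hu y hyy
  have hmem : ∀ u ∈ Ioc y X, u ∈ Icc y X := fun u hu => Ioc_subset_Icc_self hu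
  -- Both supports being one-sided, the equation may be integrated over the whole of `Ioc y X`.
  have hFsq : ∀ x ∈ Icc y X, ∀ z ∈ Icc y X,
      F (x, z) = W (x - z) + ∫ u in Ioc y X, W (x - u) * ω u * F (u, z) := by
    intro x hx z hz
    rcases lt_or_ge x z with hxz | hzx
    · rw [hF0 x z hxz, hWneg _ (by linarith), setIntegral_eq_zero_of_forall_eq_zero]
      · simp
      · intro u _
        rcases lt_or_ge x u with h | h
        · rw [hWneg _ (by linarith)]; simp
        · rw [hF0 u z (by linarith)]; simp
    · rw [hFA, intervalIntegral.integral_of_le hzx]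
      congr 1
      rw [← integral_Icc_eq_integral_Ioc, ← integral_Icc_eq_integral_Ioc]
      refine (setIntegral_eq_of_subset_of_forall_sdiff_eq_zero measurableSet_Icc
        (Icc_subset_Icc hz.1 hx.2) fun u hu => ?_).symm
      rcases lt_or_ge x u with h | h
      · rw [hWneg _ (by linarith)]; simp
      · rw [hF0 u z (lt_of_not_ge fun h' => hu.2 ⟨h', h⟩)]; simp
  set H : ℝ → ℝ := fun x => ∫ z in Ioc y X, F (x, z) * ω z * W (z - y) with hH
  have hHmeas : Measurable H := by
    have : Measurable (fun p : ℝ × ℝ => F (p.1, p.2) * ω p.2 * W (p.2 - y)) := by fun_prop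
    exact (this.stronglyMeasurable.integral_prod_right
      (ν := volume.restrict (Ioc y X))).measurable
  have hHbd : ∀ x ∈ Icc y X, |H x| ≤ C * B * A * (volume.real (Ioc y X)) := by
    intro x hx
    rw [← Real.norm_eq_abs, hH]
    refine norm_setIntegral_le_of_norm_le_const measure_Ioc_lt_top fun z hz => ?_
    rw [norm_mul, norm_mul]
    exact mul_le_mul (mul_le_mul (hC' x hx z (hmem z hz)) (hB z (hmem z hz)) (abs_nonneg _) hC0)
      (hWy z (hmem z hz)) (abs_nonneg _) (mul_nonneg hC0 hB0)
  -- Integrability of the kernel of (A) against a bounded function.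
  have hker : ∀ x ∈ Icc y X, ∀ g : ℝ → ℝ, Measurable g → ∀ c, (∀ u ∈ Icc y X, |g u| ≤ c) →
      IntegrableOn (fun u => W (x - u) * ω u * g u) (Ioc y X) := by
    intro x hx g hg c hc
    refine integrableOn_of_measurable_of_bound measurableSet_Ioc measure_Ioc_lt_top
      (by fun_prop) (C := A * B * c) fun u hu => ?_
    rw [abs_mul, abs_mul]
    gcongr
    exacts [hA' x hx u (hmem u hu), hB u (hmem u hu), hc u (hmem u hu)]
  have hFy : ∀ u ∈ Icc y X, |F (u, y)| ≤ C := fun u hu => hC' u hu y hyy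
  have hHeq : ∀ x ∈ Icc y X, H x = (∫ u in Ioc y X, W (x - u) * ω u * W (u - y))
      + ∫ u in Ioc y X, W (x - u) * ω u * H u := by
    intro x hx
    have hprod : Integrable (Function.uncurry fun z u : ℝ =>
        W (x - u) * ω u * F (u, z) * (ω z * W (z - y)))
        ((volume.restrict (Ioc y X)).prod (volume.restrict (Ioc y X))) := by
      rw [Measure.prod_restrict]
      refine integrableOn_of_measurable_of_bound (measurableSet_Ioc.prod measurableSet_Ioc)
        ?_ ?_ (C := A * B * C * (B * A)) ?_
      · rw [Measure.prod_prod]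
        exact ENNReal.mul_lt_top measure_Ioc_lt_top measure_Ioc_lt_top
      · unfold Function.uncurry; fun_prop
      · rintro ⟨z, u⟩ ⟨hz, hu⟩
        simp only [Function.uncurry, abs_mul]
        gcongr
        exacts [hA' x hx u (hmem u hu), hB u (hmem u hu), hC' u (hmem u hu) z (hmem z hz),
          hB z (hmem z hz), hWy z (hmem z hz)]
    have hswap := integral_integral_swap hprod
    have hinner : ∀ u, ∫ z in Ioc y X, W (x - u) * ω u * F (u, z) * (ω z * W (z - y))
        = W (x - u) * ω u * H u := fun u => by
      rw [hH, ← integral_const_mul]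
      congr 1; ext z; ring
    simp_rw [hinner] at hswap
    have hadd := integral_add (hker x hx (fun u => W (u - y)) (by fun_prop) A hWy)
      hprod.integral_prod_left
    simp only [Function.uncurry_apply_pair] at hadd
    rw [← hswap, ← hadd]
    refine setIntegral_congr_fun measurableSet_Ioc fun z hz => ?_
    rw [integral_mul_const, hFsq x hx z (hmem z hz)]
    ring
  set D : ℝ → ℝ := fun x => F (x, y) - W (x - y) - H x with hD
  have hDmeas : Measurable D := by fun_prop
  have hDbd : ∀ x ∈ Icc y X, |D x| ≤ C + A + C * B * A * (volume.real (Ioc y X)) := by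
    intro x hx
    have h1 := abs_sub (F (x, y) - W (x - y)) (H x)
    have h2 := abs_sub (F (x, y)) (W (x - y))
    linarith [hHbd x hx, hFy x hx, hWy x hx]
  have hDeq : ∀ x ∈ Icc y X, D x = ∫ u in Ioc y X, W (x - u) * ω u * D u := by
    intro x hx
    have i1 := hker x hx (fun u => F (u, y)) (by fun_prop) C hFy
    have i2 := hker x hx (fun u => W (u - y)) (by fun_prop) A hWy
    have i3 := hker x hx H hHmeas _ hHbd
    have i12 : IntegrableOn (fun u => W (x - u) * ω u * F (u, y) - W (x - u) * ω u * W (u - y))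
      (Ioc y X) := i1.sub i2
    simp only [hD, mul_sub]
    rw [integral_sub i12 i3, integral_sub i1 i2, hHeq x hx, hFsq x hx y hyy]
    ring
  have hDle : ∀ x ∈ Icc y X, |D x| ≤ A * B * ∫ u in Ioc y x, |D u| := by
    intro x hx
    have hsub : Ioc y x ⊆ Ioc y X := Ioc_subset_Ioc_right hx.2
    have hres : D x = ∫ u in Ioc y x, W (x - u) * ω u * D u := by
      rw [hDeq x hx]
      refine setIntegral_eq_of_subset_of_forall_sdiff_eq_zero measurableSet_Ioc hsub
        fun u hu => ?_
      rw [hWneg _ (by linarith [lt_of_not_ge fun h' => hu.2 ⟨hu.1.1, h'⟩])]; simp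
    have hi : IntegrableOn (fun u => |D u|) (Ioc y x) :=
      integrableOn_of_measurable_of_bound measurableSet_Ioc measure_Ioc_lt_top hDmeas.abs
        fun u hu => (abs_abs (D u)).le.trans (hDbd u (hmem u (hsub hu)))
    rw [hres, ← integral_const_mul]
    refine (Real.norm_eq_abs _).ge.trans (norm_integral_le_of_norm_le (hi.const_mul _)
      ((ae_restrict_iff' measurableSet_Ioc).2 (Filter.Eventually.of_forall fun u hu => ?_)))
    rw [Real.norm_eq_abs, abs_mul, abs_mul]
    gcongr
    exacts [hA' x hx u (hmem u (hsub hu)), hB u (hmem u (hsub hu))]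
  have hzero := eq_zero_of_abs_le_mul_setIntegral hDmeas (mul_nonneg hA0 hB0) hDbd hDle X
    ⟨hyX, le_rfl⟩
  rw [intervalIntegral.integral_of_le hyX]
  simp only [hD, hH] at hzero
  linarith
end
end

section
/- Fix u ∈ ℝ and let ω_u(z) := ω(u−z). If G : ℝ × ℝ → ℝ is a Borel measurable, locally bounded function satisfying equation (A) with weight ω_u, i.e. G(x,y) = W(x−y) + ∫_y^x W(x−z) ω(u−z) G(z,y) dz for all x, y ∈ ℝ, then the function g(x,y) := G(u−y, u−x) satisfies equation (B) with weight ω, i.e. g(x,y) = W(x−y) + ∫_y^x g(x,z) ω(z) W(z−y) dz for all x, y ∈ ℝ. Consequently, if F is the unique Borel measurable, locally bounded solution of equation (A) with weight ω (equivalently of equation (B) with weight ω), then G(u−y, u−x) = F(x,y) for all x, y ∈ ℝ. -/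
open MeasureTheory Set

noncomputable section

/-- If `G` solves equation (A) with the reflected weight `z ↦ ω (u - z)`, then
`g (x, y) := G (u - y, u - x)` solves the dual equation (B) with weight `ω`; consequently,
if `F` is the unique Borel measurable locally bounded solution of (A) with weight `ω`
(equivalently, of (B) with weight `ω`), then `G (u - y, u - x) = F (x, y)`. -/
theorem statement3
    (W ω : ℝ → ℝ) (u : ℝ)
    (hWmeas : Measurable W) (hWbdd : LocBdd W) (hWneg : ∀ x : ℝ, x < 0 → W x = 0)
    (hωmeas : Measurable ω) (hωbdd : LocBdd ω) (hωpos : ∀ x : ℝ, 0 ≤ ω x)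
    (G : ℝ × ℝ → ℝ) (hGmeas : Measurable G) (hGbdd : LocBdd G)
    (hGA : ∀ x y : ℝ, G (x, y) = W (x - y) + ∫ z in y..x, W (x - z) * ω (u - z) * G (z, y)) :
    (∀ x y : ℝ,
        G (u - y, u - x) = W (x - y) + ∫ z in y..x, G (u - z, u - x) * ω z * W (z - y)) ∧
    (∀ F : ℝ × ℝ → ℝ, Measurable F → LocBdd F →
      (∀ x y : ℝ, F (x, y) = W (x - y) + ∫ z in y..x, W (x - z) * ω z * F (z, y)) →
      (∀ F' : ℝ × ℝ → ℝ, Measurable F' → LocBdd F' →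
        (∀ x y : ℝ, F' (x, y) = W (x - y) + ∫ z in y..x, F' (x, z) * ω z * W (z - y)) →
        F' = F) →
      ∀ x y : ℝ, G (u - y, u - x) = F (x, y)) := by
  have key : ∀ x y : ℝ,
      G (u - y, u - x) = W (x - y) + ∫ z in y..x, G (u - z, u - x) * ω z * W (z - y) := by
    intro x y
    rw [hGA, ← intervalIntegral.integral_comp_sub_left
      (fun z => W (u - y - z) * ω (u - z) * G (z, u - x)) u, sub_sub_sub_cancel_left]
    congr 1
    refine intervalIntegral.integral_congr fun z _ => ?_
    simp only [sub_sub_sub_cancel_left, sub_sub_cancel]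
    ring
  refine ⟨key, fun F _ _ _ huniq x y => ?_⟩
  have hr : Continuous fun p : ℝ × ℝ => (u - p.2, u - p.1) := by fun_prop
  refine congrFun (huniq (fun p => G (u - p.2, u - p.1)) (hGmeas.comp hr.measurable) ?_ key) (x, y)
  intro K hK
  obtain ⟨C, hC⟩ := hGbdd _ (hK.image hr)
  exact ⟨C, fun p hp => hC _ (mem_image_of_mem _ hp)⟩
end
end

section
/- Let F : ℝ × ℝ → ℝ be the Borel measurable, locally bounded solution of equation (A) with weight ω. Then for every x > y the right partial derivative of F(·,y) at x exists and equals W′(x−y) + ∫_y^x W′(x−z) ω(z) F(z,y) dz + W(0) ω(x) F(x,y). -/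
open MeasureTheory Set Filter

noncomputable section

/-- Fubini for the convolution of two integrable functions. -/
theorem intervalIntegral_convolution {g w : ℝ → ℝ} (hg : Integrable g) (hw : Integrable w)
    (a b : ℝ) :
    ∫ u in a..b, ∫ z, g z * w (u - z) = ∫ z, g z * ∫ s in (a - z)..(b - z), w s := by
  have hprod : Integrable (fun p : ℝ × ℝ => g p.2 * w (p.1 - p.2)) (volume.prod volume) :=
    Integrable.convolution_integrand (ContinuousLinearMap.mul ℝ ℝ) hg hw
  rw [intervalIntegral_integral_swap (f := fun u z => g z * w (u - z))
    (hprod.mono_measure (Measure.prod_mono Measure.restrict_le_self le_rfl))]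
  refine integral_congr_ae (Eventually.of_forall fun z => ?_)
  simp only [intervalIntegral.integral_const_mul, intervalIntegral.integral_comp_sub_right]

/-- The convolution of an integrable function with a bounded measurable function is right-continuous
at `x` if the bounded function is right-continuous off a single point. -/
theorem continuousWithinAt_convolution {g w : ℝ → ℝ} (hg : Measurable g) {C : ℝ}
    (hgC : ∀ z, |g z| ≤ C) (hw : Integrable w) {a : ℝ}
    (hgrc : ∀ z ≠ a, ContinuousWithinAt g (Ici z) z) (x : ℝ) :
    ContinuousWithinAt (fun u => ∫ z, g z * w (u - z)) (Ici x) x := by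
  have hswap : (fun u => ∫ z, g z * w (u - z)) = fun u => ∫ s, g (u - s) * w s := by
    funext u
    rw [← integral_sub_left_eq_self _ volume u]
    simp
  rw [hswap]
  refine continuousWithinAt_of_dominated (bound := fun s => C * |w s|)
    (Eventually.of_forall fun u => ?_) (Eventually.of_forall fun u => ?_)
    (hw.abs.const_mul C) ?_
  · exact (hg.comp (measurable_const.sub measurable_id)).aestronglyMeasurable.mul
      hw.aestronglyMeasurable
  · refine Eventually.of_forall fun s => ?_
    rw [Real.norm_eq_abs, abs_mul]
    exact mul_le_mul_of_nonneg_right (hgC _) (abs_nonneg _)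
  · filter_upwards [Measure.ae_ne volume (x - a)] with s hs
    refine ContinuousWithinAt.mul ?_ continuousWithinAt_const
    refine ContinuousWithinAt.comp (t := Ici (x - s))
      (hgrc (x - s) fun h => hs (by linarith)) (by fun_prop) ?_
    intro u hu
    exact sub_le_sub_right (mem_Ici.mp hu) s

/-- For `g` supported in `[a, b)`, integrating the kernel `W` against `g` amounts to integrating the
convolution of `g` with the derivative of `W`, up to the jump of `W` at zero. -/
theorem integral_kernel_mul_eq {W W' g : ℝ → ℝ} {a b v : ℝ}
    (hWcont : ContinuousOn W (Ici 0))
    (hWderiv : ∀ x : ℝ, 0 < x → HasDerivAt W (W' x) x)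
    (hW'int : ∀ b : ℝ, 0 < b → IntervalIntegrable W' volume 0 b)
    (hg : Integrable g) (hgsupp : ∀ z, z ∉ Ico a b → g z = 0) (hv : v ∈ Ico a b) :
    ∫ z in a..v, W (v - z) * g z = W 0 * (∫ z in a..v, g z) +
      ∫ u in a..v, ∫ z, g z * (Ioc 0 (b - a)).indicator W' (u - z) := by
  obtain ⟨hav, hvb⟩ := hv
  have hba : 0 < b - a := by linarith
  have hw : Integrable ((Ioc 0 (b - a)).indicator W') :=
    (integrable_indicator_iff measurableSet_Ioc).2
      ((intervalIntegrable_iff_integrableOn_Ioc_of_le hba.le).1 (hW'int _ hba))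
  have hker : ContinuousOn (fun z => W (v - z)) (uIcc a v) := by
    rw [uIcc_of_le hav]
    exact hWcont.comp (by fun_prop) fun z hz => sub_nonneg.2 hz.2
  have hinner : ∀ z, g z * (∫ s in (a - z)..(v - z), (Ioc 0 (b - a)).indicator W' s) =
      (Icc a v).indicator (fun z => W (v - z) * g z - W 0 * g z) z := by
    intro z
    by_cases hz : z ∈ Ico a b
    swap
    · rw [hgsupp z hz, indicator_apply]
      simp [hgsupp z hz]
    rw [intervalIntegral.integral_of_le (by linarith), integral_indicator measurableSet_Ioc,
      Measure.restrict_restrict measurableSet_Ioc, Ioc_inter_Ioc]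
    rw [max_eq_left (by linarith [hz.1]), min_eq_right (by linarith [hz.1])]
    by_cases hzv : z ≤ v
    · rw [indicator_of_mem (show z ∈ Icc a v from ⟨hz.1, hzv⟩),
        ← intervalIntegral.integral_of_le (by linarith),
        intervalIntegral.integral_eq_sub_of_hasDerivAt_of_le (f := W) (by linarith)
          (hWcont.mono Icc_subset_Ici_self) (fun s hs => hWderiv s hs.1)]
      · ring
      · rcases hzv.eq_or_lt with rfl | h
        · simp
        · exact hW'int _ (by linarith)
    · rw [indicator_of_notMem (fun h => hzv h.2), Ioc_eq_empty (by linarith)]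
      simp
  rw [intervalIntegral_convolution hg hw, integral_congr_ae (Eventually.of_forall hinner),
    integral_indicator measurableSet_Icc, integral_Icc_eq_integral_Ioc,
    ← intervalIntegral.integral_of_le hav, intervalIntegral.integral_sub
      (hg.intervalIntegrable.continuousOn_mul hker) (hg.intervalIntegrable.const_mul _),
    intervalIntegral.integral_const_mul]
  ring

/-- The right partial derivative of `W^{(ω)}(·, y)` at `x > y` exists and equals
`W'(x-y) + ∫_y^x W'(x-z) ω(z) W^{(ω)}(z,y) dz + W(0) ω(x) W^{(ω)}(x,y)`. -/
theorem statement10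
    (W W' ω : ℝ → ℝ)
    (hWneg : ∀ x : ℝ, x < 0 → W x = 0)
    (hWcont : ContinuousOn W (Set.Ici 0))
    (hWmono : MonotoneOn W (Set.Ici 0))
    (hWderiv : ∀ x : ℝ, 0 < x → HasDerivAt W (W' x) x)
    (hW'cont : ContinuousOn W' (Set.Ioi 0))
    (hW'nonneg : ∀ x : ℝ, 0 < x → 0 ≤ W' x)
    (hW'int : ∀ b : ℝ, 0 < b → IntervalIntegrable W' MeasureTheory.volume 0 b)
    (hωmeas : Measurable ω) (hωbdd : LocBdd ω) (hωpos : ∀ x : ℝ, 0 ≤ ω x)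
    (hωrc : ∀ x : ℝ, ContinuousWithinAt ω (Set.Ici x) x)
    (hωll : ∀ x : ℝ, ∃ l : ℝ, Tendsto ω (nhdsWithin x (Set.Iio x)) (nhds l))
    (F : ℝ × ℝ → ℝ) (hFmeas : Measurable F) (hFbdd : LocBdd F)
    (hFA : ∀ x y : ℝ, F (x, y) = W (x - y) + ∫ z in y..x, W (x - z) * ω z * F (z, y)) :
    ∀ x y : ℝ, y < x →
      HasDerivWithinAt (fun v => F (v, y))
        (W' (x - y) + (∫ z in y..x, W' (x - z) * ω z * F (z, y)) + W 0 * ω x * F (x, y))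
        (Set.Ici x) x := by
  intro x y hyx
  set b : ℝ := x + 1
  set g : ℝ → ℝ := (Ico y b).indicator fun z => ω z * F (z, y)
  set H : ℝ → ℝ := fun u => ∫ z, g z * (Ioc 0 (b - y)).indicator W' (u - z)
  have hby : 0 < b - y := by linarith
  have hw : Integrable ((Ioc 0 (b - y)).indicator W') :=
    (integrable_indicator_iff measurableSet_Ioc).2
      ((intervalIntegrable_iff_integrableOn_Ioc_of_le hby.le).1 (hW'int _ hby))
  have hgmeas : Measurable g :=
    (hωmeas.mul (hFmeas.comp (measurable_id.prodMk measurable_const))).indicator measurableSet_Ico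
  have hgsupp : ∀ z, z ∉ Ico y b → g z = 0 := fun z hz => indicator_of_notMem hz _
  have hgeq : ∀ z ∈ Ico y b, g z = ω z * F (z, y) := fun z hz => indicator_of_mem hz _
  obtain ⟨C, hgC⟩ : ∃ C, ∀ z, |g z| ≤ C := by
    obtain ⟨C₁, hC₁⟩ := hωbdd (Icc y b) isCompact_Icc
    obtain ⟨C₂, hC₂⟩ := hFbdd (Icc y b ×ˢ {y}) (isCompact_Icc.prod isCompact_singleton)
    have hC₁0 : 0 ≤ C₁ := (abs_nonneg _).trans (hC₁ y ⟨le_rfl, by linarith⟩)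
    have hC₂0 : 0 ≤ C₂ := (abs_nonneg _).trans (hC₂ (y, y) ⟨⟨le_rfl, by simp; linarith⟩, rfl⟩)
    refine ⟨C₁ * C₂, fun z => ?_⟩
    by_cases hz : z ∈ Ico y b
    · rw [hgeq z hz, abs_mul]
      exact mul_le_mul (hC₁ z (Ico_subset_Icc_self hz))
        (hC₂ (z, y) ⟨Ico_subset_Icc_self hz, rfl⟩) (abs_nonneg _) hC₁0
    · rw [hgsupp z hz, abs_zero]
      exact mul_nonneg hC₁0 hC₂0
  have hgint : Integrable g := by
    refine (integrableOn_iff_integrable_of_support_subset (s := Ico y b)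
      fun z hz => by_contra fun h => hz (hgsupp z h)).1 ?_
    exact Measure.integrableOn_of_bounded (M := C) (by simp) hgmeas.aestronglyMeasurable
      (Eventually.of_forall hgC)
  have hHint : Integrable H :=
    (Integrable.convolution_integrand (ContinuousLinearMap.mul ℝ ℝ) hgint hw).integral_prod_left
  have hF : ∀ v ∈ Ico y b,
      F (v, y) = W (v - y) + (W 0 * (∫ z in y..v, g z) + ∫ u in y..v, H u) := by
    intro v hv
    rw [hFA v y, ← integral_kernel_mul_eq hWcont hWderiv hW'int hgint hgsupp hv]
    congr 1
    refine intervalIntegral.integral_congr fun z hz => ?_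
    rw [uIcc_of_le hv.1] at hz
    simp only [hgeq z ⟨hz.1, hz.2.trans_lt hv.2⟩, mul_assoc]
  have hFcont : ∀ v ∈ Ioo y b, ContinuousAt (fun v => F (v, y)) v := by
    intro v hv
    have hev : (fun v => F (v, y)) =ᶠ[nhds v]
        fun v => W (v - y) + (W 0 * (∫ z in y..v, g z) + ∫ u in y..v, H u) := by
      filter_upwards [Ioo_mem_nhds hv.1 hv.2] with u hu using hF u (Ioo_subset_Ico_self hu)
    refine ContinuousAt.congr ?_ hev.symm
    refine ContinuousAt.add ?_ (ContinuousAt.add (continuousAt_const.mul ?_) ?_)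
    · exact ContinuousAt.comp (g := W) (hWderiv _ (sub_pos.2 hv.1)).continuousAt (by fun_prop)
    · exact (intervalIntegral.continuous_primitive
        (fun _ _ => hgint.intervalIntegrable) y).continuousAt
    · exact (intervalIntegral.continuous_primitive
        (fun _ _ => hHint.intervalIntegrable) y).continuousAt
  have hgrc : ∀ z ≠ y, ContinuousWithinAt g (Ici z) z := by
    intro z hzy
    rcases lt_or_gt_of_ne hzy with h | h
    · refine (continuousAt_const (y := (0 : ℝ))).congr ?_ |>.continuousWithinAt
      filter_upwards [Iio_mem_nhds h] with u hu
      exact (hgsupp u fun h' => not_lt.2 h'.1 hu).symm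
    · rcases lt_or_ge z b with hzb | hzb
      · refine ContinuousWithinAt.congr_of_eventuallyEq
          ((hωrc z).mul (hFcont z ⟨h, hzb⟩).continuousWithinAt) ?_ (hgeq z ⟨h.le, hzb⟩)
        filter_upwards [mem_nhdsWithin_of_mem_nhds (Ioo_mem_nhds h hzb)] with u hu
        exact hgeq u (Ioo_subset_Ico_self hu)
      · refine (continuousWithinAt_const (b := (0 : ℝ))).congr (fun u hu => ?_) ?_
        · exact hgsupp u fun h' => not_le.2 h'.2 (hzb.trans hu)
        · exact hgsupp z fun h' => not_le.2 h'.2 hzb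
  have hxb : x ∈ Ico y b := ⟨hyx.le, by linarith⟩
  have hHx : H x = ∫ z in y..x, W' (x - z) * ω z * F (z, y) := by
    rw [intervalIntegral.integral_of_le hyx.le, ← integral_Ico_eq_integral_Ioc,
      ← integral_indicator measurableSet_Ico]
    refine integral_congr_ae (Eventually.of_forall fun z => ?_)
    by_cases hz : z ∈ Ico y x
    · have h₁ : z ∈ Ico y b := ⟨hz.1, hz.2.trans hxb.2⟩
      have h₂ : x - z ∈ Ioc 0 (b - y) := ⟨sub_pos.2 hz.2, by linarith [hz.1, hxb.2]⟩
      simp only [hgeq z h₁, indicator_of_mem h₂, indicator_of_mem hz]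
      ring
    · simp only [indicator_of_notMem hz]
      by_cases h₁ : z ∈ Ico y b
      · have h₂ : x - z ∉ Ioc 0 (b - y) := fun h => hz ⟨h₁.1, sub_pos.1 h.1⟩
        rw [indicator_of_notMem h₂, mul_zero]
      · rw [hgsupp z h₁, zero_mul]
  have hdW : HasDerivWithinAt (fun v => W (v - y)) (W' (x - y)) (Ici x) x :=
    ((hWderiv _ (sub_pos.2 hyx)).comp_sub_const x y).hasDerivWithinAt
  have hdg : HasDerivWithinAt (fun v => ∫ z in y..v, g z) (g x) (Ici x) x :=
    intervalIntegral.integral_hasDerivWithinAt_right (t := Ioi x) hgint.intervalIntegrable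
      hgint.aestronglyMeasurable.stronglyMeasurableAtFilter
      ((hgrc x hyx.ne').mono Ioi_subset_Ici_self)
  have hdH : HasDerivWithinAt (fun v => ∫ u in y..v, H u) (H x) (Ici x) x :=
    intervalIntegral.integral_hasDerivWithinAt_right (t := Ioi x) hHint.intervalIntegrable
      hHint.aestronglyMeasurable.stronglyMeasurableAtFilter
      ((continuousWithinAt_convolution hgmeas hgC hw hgrc x).mono Ioi_subset_Ici_self)
  have hd := hdW.add ((hdg.const_mul (W 0)).add hdH)
  refine (hd.congr_of_eventuallyEq ?_ (hF x hxb)).congr_deriv ?_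
  · filter_upwards [mem_nhdsWithin_of_mem_nhds (Ioo_mem_nhds hyx hxb.2)] with u hu
    exact hF u (Ioo_subset_Ico_self hu)
  · rw [← hHx, hgeq x hxb]
    ring
end
end

section
/- Let b > 0 and let k, g : [0,b] → ℝ be continuous. If u : [0,b] → ℝ is a continuous function satisfying u(x) = g(x) + ∫_x^b k(z) u(z) dz for all x ∈ [0,b], then u(x) = g(x) + ∫_x^b exp(∫_x^z k(s) ds) · k(z) g(z) dz for all x ∈ [0,b]. In particular, the backward linear Volterra equation u(x) = g(x) + ∫_x^b k(z) u(z) dz has a unique continuous solution on [0,b]. -/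
open MeasureTheory Set

noncomputable section

/-- The integral of a function continuous on `[a, b]` is differentiable in its upper limit at
interior points. -/
theorem hasDerivAt_integral_of_continuousOn_Icc {a b z : ℝ} {f : ℝ → ℝ}
    (hf : ContinuousOn f (Icc a b)) (hz : z ∈ Ioo a b) :
    HasDerivAt (fun y => ∫ t in a..y, f t) (f z) z := by
  refine intervalIntegral.integral_hasDerivAt_right ?_ ?_ ?_
  · exact (hf.mono (Icc_subset_Icc_right hz.2.le)).intervalIntegrable_of_Icc hz.1.le
  · exact (hf.mono Ioo_subset_Icc_self).stronglyMeasurableAtFilter isOpen_Ioo z hz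
  · exact hf.continuousAt (Icc_mem_nhds hz.1 hz.2)

/-- The integral of a function continuous on `[a, b]` is continuous in its upper limit. -/
theorem continuousOn_integral_of_continuousOn_Icc {a b : ℝ} {f : ℝ → ℝ} (hab : a ≤ b)
    (hf : ContinuousOn f (Icc a b)) :
    ContinuousOn (fun y => ∫ t in a..y, f t) (Icc a b) := by
  have h := intervalIntegral.continuousOn_primitive_interval' (a := a)
    (hf.intervalIntegrable_of_Icc (μ := volume) hab) left_mem_uIcc
  rwa [uIcc_of_le hab] at h

/-- A continuous solution of the backward Volterra equation on `[a, b]` is given at `a` by the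
explicit formula. -/
theorem eq_add_integral_exp_mul_of_backward_volterra {a b : ℝ} {k g u : ℝ → ℝ} (hab : a ≤ b)
    (hk : ContinuousOn k (Icc a b)) (hg : ContinuousOn g (Icc a b))
    (hu : ContinuousOn u (Icc a b))
    (heq : ∀ x ∈ Icc a b, u x = g x + ∫ z in x..b, k z * u z) :
    u a = g a + ∫ z in a..b, Real.exp (∫ s in a..z, k s) * (k z * g z) := by
  have hK := continuousOn_integral_of_continuousOn_Icc hab hk
  have hderiv : ∀ z ∈ Ioo a b,
      HasDerivAt (fun y => -(Real.exp (∫ s in a..y, k s) *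
        ((∫ t in a..b, k t * u t) - ∫ t in a..y, k t * u t)))
        (Real.exp (∫ s in a..z, k s) * (k z * g z)) z := by
    intro z hz
    have hsplit : (∫ t in a..z, k t * u t) + ∫ t in z..b, k t * u t = ∫ t in a..b, k t * u t :=
      intervalIntegral.integral_add_adjacent_intervals
        (((hk.mul hu).mono (Icc_subset_Icc_right hz.2.le)).intervalIntegrable_of_Icc hz.1.le)
        (((hk.mul hu).mono (Icc_subset_Icc_left hz.1.le)).intervalIntegrable_of_Icc hz.2.le)
    have hgz : g z = u z - ((∫ t in a..b, k t * u t) - ∫ t in a..z, k t * u t) := by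
      linarith [heq z (Ioo_subset_Icc_self hz)]
    have hexp := (hasDerivAt_integral_of_continuousOn_Icc hk hz).exp
    have hsub := (hasDerivAt_integral_of_continuousOn_Icc (hk.mul hu) hz).const_sub
      (∫ t in a..b, k t * u t)
    refine (hexp.mul hsub).neg.congr_deriv ?_
    rw [hgz]
    simp only [Pi.mul_apply]
    ring
  have hftc := intervalIntegral.integral_eq_sub_of_hasDerivAt_of_le hab
    (hK.rexp.mul (continuousOn_const.sub
      (continuousOn_integral_of_continuousOn_Icc hab (hk.mul hu)))).neg hderiv
    ((hK.rexp.mul (hk.mul hg)).intervalIntegrable_of_Icc hab)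
  rw [heq a (left_mem_Icc.mpr hab), hftc]
  simp

/-- A continuous solution of the backward linear Volterra equation
`u(x) = g(x) + ∫_x^b k(z) u(z) dz` on `[0, b]` is given by the explicit formula
`u(x) = g(x) + ∫_x^b exp(∫_x^z k) k(z) g(z) dz`; in particular the equation has a
unique continuous solution on `[0, b]`. -/
theorem statement14
    (b : ℝ) (hb : 0 < b)
    (k g : ℝ → ℝ)
    (hk : ContinuousOn k (Set.Icc 0 b)) (hg : ContinuousOn g (Set.Icc 0 b))
    (u : ℝ → ℝ) (hu : ContinuousOn u (Set.Icc 0 b))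
    (heq : ∀ x ∈ Set.Icc (0 : ℝ) b, u x = g x + ∫ z in x..b, k z * u z) :
    (∀ x ∈ Set.Icc (0 : ℝ) b,
        u x = g x + ∫ z in x..b, Real.exp (∫ s in x..z, k s) * (k z * g z)) ∧
    (∀ v : ℝ → ℝ, ContinuousOn v (Set.Icc 0 b) →
      (∀ x ∈ Set.Icc (0 : ℝ) b, v x = g x + ∫ z in x..b, k z * v z) →
      ∀ x ∈ Set.Icc (0 : ℝ) b, v x = u x) := by
  have formula : ∀ w : ℝ → ℝ, ContinuousOn w (Icc 0 b) →
      (∀ x ∈ Icc (0 : ℝ) b, w x = g x + ∫ z in x..b, k z * w z) →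
      ∀ x ∈ Icc (0 : ℝ) b,
        w x = g x + ∫ z in x..b, Real.exp (∫ s in x..z, k s) * (k z * g z) := by
    intro w hw hweq x hx
    have hsub : Icc x b ⊆ Icc 0 b := Icc_subset_Icc_left hx.1
    exact eq_add_integral_exp_mul_of_backward_volterra hx.2 (hk.mono hsub) (hg.mono hsub)
      (hw.mono hsub) fun y hy => hweq y (hsub hy)
  exact ⟨formula u hu heq, fun v hv hveq x hx =>
    (formula v hv hveq x hx).trans (formula u hu heq x hx).symm⟩
end
end
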